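/- Every element of the Kauffman monoid K_3 is equal to exactly one element from the disjoint union of the five sets C = {c^k : k ≥ 0}, H_11 = {c^ℓ h_1 : ℓ ≥ 0}, H_12 = {c^m h_1h_2 : m ≥ 0}, H_21 = {c^n h_2h_1 : n ≥ 0}, H_22 = {c^r h_2 : r ≥ 0}; that is, the map sending each of the listed formal expressions to the corresponding element of K_3 is a bijection onto K_3. -/

import Mathlib

open scoped Classical

/-- Generators of the Kauffman monoid `K₃`. -/
inductive K3Gen : Type
  | h1 | h2 | c
deriving DecidableEq

namespace K3Gen

/-- The defining relations of the Kauffman monoid `K₃`: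
`h₁h₂h₁ = h₁`, `h₂h₁h₂ = h₂`, `h₁² = ch₁ = h₁c`, `h₂² = ch₂ = h₂c`. -/
inductive K3Rel : FreeMonoid K3Gen → FreeMonoid K3Gen → Prop
  | braid1 : K3Rel (.of h1 * .of h2 * .of h1) (.of h1)
  | braid2 : K3Rel (.of h2 * .of h1 * .of h2) (.of h2)
  | sq1 : K3Rel (.of h1 * .of h1) (.of c * .of h1)
  | comm1 : K3Rel (.of c * .of h1) (.of h1 * .of c)
  | sq2 : K3Rel (.of h2 * .of h2) (.of c * .of h2)
  | comm2 : K3Rel (.of c * .of h2) (.of h2 * .of c)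

end K3Gen

/-- The congruence on the free monoid over the generators generated by the relations. -/
def K3Con : Con (FreeMonoid K3Gen) := conGen K3Gen.K3Rel

/-- The Kauffman monoid `K₃`. -/
def K3 : Type := K3Con.Quotient

instance : Monoid K3 := Con.monoid K3Con

namespace K3

/-- The generator `h₁` of `K₃`. -/
def h1 : K3 := K3Con.mk' (.of .h1)
/-- The generator `h₂` of `K₃`. -/
def h2 : K3 := K3Con.mk' (.of .h2)
/-- The generator `c` of `K₃`. -/
def c : K3 := K3Con.mk' (.of .c)

end K3

/-- The identity `w ≍ w'` (words over the countably infinite alphabet `ℕ`) holds in the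
monoid `M` if every monoid homomorphism from the free monoid over `ℕ` to `M` equalizes
`w` and `w'`. -/
def HoldsIn (M : Type*) [Monoid M] (w w' : List ℕ) : Prop :=
  ∀ φ : FreeMonoid ℕ →* M, φ (FreeMonoid.ofList w) = φ (FreeMonoid.ofList w')

/-- The formal expressions `c^k`, `c^ℓh₁`, `c^mh₁h₂`, `c^nh₂h₁`, `c^rh₂` indexing the
five sets `C`, `H₁₁`, `H₁₂`, `H₂₁`, `H₂₂`, together with the map sending each such
expression to the corresponding element of `K₃`. -/
def normalForm : ℕ ⊕ ℕ ⊕ ℕ ⊕ ℕ ⊕ ℕ → K3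
  | .inl k => K3.c ^ k
  | .inr (.inl l) => K3.c ^ l * K3.h1
  | .inr (.inr (.inl m)) => K3.c ^ m * K3.h1 * K3.h2
  | .inr (.inr (.inr (.inl n))) => K3.c ^ n * K3.h2 * K3.h1
  | .inr (.inr (.inr (.inr r))) => K3.c ^ r * K3.h2

abbrev K3NF : Type := ℕ ⊕ ℕ ⊕ ℕ ⊕ ℕ ⊕ ℕ

/-- Left multiplication by a generator, on normal forms. -/
def K3act : K3Gen → K3NF → K3NF
  | .c, .inl k => .inl (k + 1)
  | .c, .inr (.inl k) => .inr (.inl (k + 1))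
  | .c, .inr (.inr (.inl k)) => .inr (.inr (.inl (k + 1)))
  | .c, .inr (.inr (.inr (.inl k))) => .inr (.inr (.inr (.inl (k + 1))))
  | .c, .inr (.inr (.inr (.inr k))) => .inr (.inr (.inr (.inr (k + 1))))
  | .h1, .inl k => .inr (.inl k)
  | .h1, .inr (.inl k) => .inr (.inl (k + 1))
  | .h1, .inr (.inr (.inl k)) => .inr (.inr (.inl (k + 1)))
  | .h1, .inr (.inr (.inr (.inl k))) => .inr (.inl k)
  | .h1, .inr (.inr (.inr (.inr k))) => .inr (.inr (.inl k))
  | .h2, .inl k => .inr (.inr (.inr (.inr k)))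
  | .h2, .inr (.inl k) => .inr (.inr (.inr (.inl k)))
  | .h2, .inr (.inr (.inl k)) => .inr (.inr (.inr (.inr k)))
  | .h2, .inr (.inr (.inr (.inl k))) => .inr (.inr (.inr (.inl (k + 1))))
  | .h2, .inr (.inr (.inr (.inr k))) => .inr (.inr (.inr (.inr (k + 1))))

def K3actHom : FreeMonoid K3Gen →* Function.End K3NF :=
  FreeMonoid.lift (fun g => (K3act g : Function.End K3NF))

theorem K3actHom_le : K3Con ≤ Con.ker K3actHom := by
  refine Con.conGen_le.2 ?_
  intro x y h
  rw [Con.ker_rel]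
  cases h <;> simp only [map_mul, K3actHom, FreeMonoid.lift_eval_of] <;> funext x <;>
    rcases x with k | k | k | k | k <;> rfl

def K3phi : K3 →* Function.End K3NF := K3Con.lift K3actHom K3actHom_le

theorem K3phi_c : K3phi K3.c = K3act .c := rfl
theorem K3phi_h1 : K3phi K3.h1 = K3act .h1 := rfl
theorem K3phi_h2 : K3phi K3.h2 = K3act .h2 := rfl

theorem K3end_mul (f g : Function.End K3NF) (x : K3NF) : (f * g) x = f (g x) := rfl

theorem K3phi_normalForm (x : K3NF) : K3phi (normalForm x) (.inl 0) = x := by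
  rcases x with k | k | k | k | k <;> simp only [normalForm] <;> induction k with
  | zero => simp only [pow_zero, one_mul, map_mul, map_one, K3phi_h1, K3phi_h2]; rfl
  | succ n ih =>
    simp only [pow_succ', mul_assoc] at ih ⊢
    rw [map_mul, K3end_mul, ih]; rfl

theorem K3rel {x y : FreeMonoid K3Gen} (h : K3Gen.K3Rel x y) : K3Con.mk' x = K3Con.mk' y :=
  (Con.eq K3Con).2 (ConGen.Rel.of _ _ h)

theorem K3_braid1 : K3.h1 * (K3.h2 * K3.h1) = K3.h1 := K3rel .braid1
theorem K3_braid2 : K3.h2 * (K3.h1 * K3.h2) = K3.h2 := K3rel .braid2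
theorem K3_sq1 : K3.h1 * K3.h1 = K3.c * K3.h1 := K3rel .sq1
theorem K3_sq2 : K3.h2 * K3.h2 = K3.c * K3.h2 := K3rel .sq2
theorem K3_comm1 : Commute K3.h1 K3.c := (K3rel .comm1).symm
theorem K3_comm2 : Commute K3.h2 K3.c := (K3rel .comm2).symm

theorem K3pull1 (k : ℕ) (x : K3) : K3.h1 * (K3.c ^ k * x) = K3.c ^ k * (K3.h1 * x) := by
  rw [← mul_assoc, (K3_comm1.pow_right k).eq, mul_assoc]
theorem K3pull2 (k : ℕ) (x : K3) : K3.h2 * (K3.c ^ k * x) = K3.c ^ k * (K3.h2 * x) := by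
  rw [← mul_assoc, (K3_comm2.pow_right k).eq, mul_assoc]

theorem normalForm_act (g : K3Gen) (x : K3NF) :
    normalForm (K3act g x) = (show K3 from K3Con.mk' (.of g)) * normalForm x := by
  cases g
  · change _ = K3.h1 * _
    rcases x with k | k | k | k | k <;> simp only [normalForm, K3act, mul_assoc, K3pull1]
    · rw [(K3_comm1.pow_right k).eq]
    · rw [K3_sq1, pow_succ, mul_assoc]
    · rw [← mul_assoc K3.h1 K3.h1, K3_sq1, pow_succ, mul_assoc, mul_assoc]
    · rw [K3_braid1]
  · change _ = K3.h2 * _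
    rcases x with k | k | k | k | k <;> simp only [normalForm, K3act, mul_assoc, K3pull2]
    · rw [(K3_comm2.pow_right k).eq]
    · rw [K3_braid2]
    · rw [← mul_assoc K3.h2 K3.h2, K3_sq2, pow_succ, mul_assoc, mul_assoc]
    · rw [K3_sq2, pow_succ, mul_assoc]
  · change _ = K3.c * _
    rcases x with k | k | k | k | k <;> simp only [normalForm, K3act, mul_assoc, pow_succ']

/-- Every element of the Kauffman monoid `K₃` is equal to exactly one element from the
disjoint union of the five sets `C = {cᵏ}`, `H₁₁ = {cˡh₁}`, `H₁₂ = {cᵐh₁h₂}`,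
`H₂₁ = {cⁿh₂h₁}`, `H₂₂ = {cʳh₂}`: the map sending each formal expression to the
corresponding element of `K₃` is a bijection onto `K₃`. -/
theorem normalForm_bijective : Function.Bijective normalForm := by
  constructor
  · intro x y h
    rw [← K3phi_normalForm x, h, K3phi_normalForm y]
  · intro y
    obtain ⟨w, rfl⟩ := Con.mk'_surjective (c := K3Con) y
    induction w using FreeMonoid.inductionOn' with
    | one => exact ⟨.inl 0, pow_zero _⟩
    | of_mul g w ih =>
      obtain ⟨x, hx⟩ := ih
      exact ⟨K3act g x, by rw [normalForm_act, hx]; rfl⟩
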